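/- Let d ≥ 1 be an integer, let G be a bipartite graph with parts A and B, each of size n ≥ 1, let Δ_A be the maximum degree in G among vertices of A and Δ_B the maximum degree in G among vertices of B, and let f(x) = min(1, (d+1)/(x+1)). Then β_d(G) ≥ (1/2)·(f(Δ_A) + f(Δ_B) + ∑_{v ∈ A ∪ B} f(d(v))) − 1. -/

import Mathlib

open Finset

/-- `degenBiholeNumber d G A B` is `β_d(G)`: the largest `k` such that there are `S ⊆ A`,
`T ⊆ B` with `|S| = |T| = k` and the subgraph of `G` induced on `S ∪ T` is `d`-degenerate,
i.e. every nonempty subset `s` of `S ∪ T` contains a vertex of degree at most `d` in the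
subgraph induced on `s`. -/
noncomputable def degenBiholeNumber {V : Type*} [DecidableEq V] (d : ℕ)
    (G : SimpleGraph V) [DecidableRel G.Adj] (A B : Finset V) : ℕ :=
  sSup {k | ∃ S T : Finset V, S ⊆ A ∧ T ⊆ B ∧ S.card = k ∧ T.card = k ∧
    ∀ s : Finset V, s ⊆ S ∪ T → s.Nonempty →
      ∃ v ∈ s, (s.filter (fun u => G.Adj v u)).card ≤ d}


noncomputable def cwF (d k : ℕ) : ℝ := min 1 (((d : ℝ) + 1) / ((k : ℝ) + 1))

lemma cwF_anti (d : ℕ) {a b : ℕ} (h : a ≤ b) : cwF d b ≤ cwF d a := by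
  unfold cwF
  have : (a : ℝ) ≤ b := by exact_mod_cast h
  gcongr

lemma cwF_le_one (d a : ℕ) : cwF d a ≤ 1 := min_le_left _ _

lemma cwF_eq (d k : ℕ) (h : d ≤ k) : cwF d k = ((d : ℝ) + 1) / ((k : ℝ) + 1) := by
  unfold cwF
  apply min_eq_right
  have : (d : ℝ) ≤ k := by exact_mod_cast h
  rw [div_le_one (by positivity)]
  linarith

noncomputable def cwC (d k : ℕ) : ℝ := ((d : ℝ) + 1) / ((k : ℝ) * ((k : ℝ) + 1))

lemma cwF_pred (d k : ℕ) (h : d + 1 ≤ k) : cwF d (k - 1) = cwF d k + cwC d k := by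
  obtain ⟨m, rfl⟩ : ∃ m, k = m + 1 := ⟨k - 1, by omega⟩
  rw [cwF_eq d (m + 1) (by omega), Nat.add_sub_cancel, cwF_eq d m (by omega), cwC]
  push_cast
  have : (m : ℝ) + 1 ≠ 0 := by positivity
  have : (m : ℝ) + 1 + 1 ≠ 0 := by positivity
  field_simp

lemma cwC_anti (d : ℕ) {a b : ℕ} (ha : 0 < a) (h : a ≤ b) : cwC d b ≤ cwC d a := by
  unfold cwC
  have h1 : (a : ℝ) ≤ b := by exact_mod_cast h
  have h2 : (0 : ℝ) < a := by exact_mod_cast ha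
  gcongr

lemma cw_ineq (d x y : ℕ) (hx : d + 1 ≤ x) (hy : d + 1 ≤ y) :
    cwF d x + cwF d y ≤ x * cwC d y + y * cwC d x := by
  have h1 : cwF d x = x * cwC d x := by
    rw [cwF_eq d x (by omega), cwC]
    have : (0 : ℝ) < x := by exact_mod_cast (by omega : 0 < x)
    field_simp
  have h2 : cwF d y = y * cwC d y := by
    rw [cwF_eq d y (by omega), cwC]
    have : (0 : ℝ) < y := by exact_mod_cast (by omega : 0 < y)
    field_simp
  rw [h1, h2]
  rcases le_total x y with h | h
  · have h3 := cwC_anti d (by omega : 0 < x) h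
    have h4 : (x : ℝ) ≤ y := by exact_mod_cast h
    nlinarith
  · have h3 := cwC_anti d (by omega : 0 < y) h
    have h4 : (y : ℝ) ≤ x := by exact_mod_cast h
    nlinarith

section
variable {V : Type*} [DecidableEq V] (G : SimpleGraph V) [DecidableRel G.Adj]

def cwDeg (Z : Finset V) (v : V) : ℕ := (Z.filter (fun u => G.Adj v u)).card

lemma cwDeg_mono {Z W : Finset V} (h : Z ⊆ W) (v : V) : cwDeg G Z v ≤ cwDeg G W v :=
  card_le_card (filter_subset_filter _ h)

lemma cwDeg_erase_adj {Z : Finset V} {v w : V} (hw : w ∈ Z) (h : G.Adj v w) :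
    cwDeg G (Z.erase w) v = cwDeg G Z v - 1 := by
  unfold cwDeg
  rw [filter_erase, card_erase_of_mem]
  simp [hw, h]

lemma cwDeg_erase_not {Z : Finset V} {v w : V} (h : ¬ G.Adj v w) :
    cwDeg G (Z.erase w) v = cwDeg G Z v := by
  unfold cwDeg
  rw [filter_erase, erase_eq_of_notMem]
  simp [h]

noncomputable def cwPhi (d : ℕ) (X Y : Finset V) : ℝ :=
  cwF d (X.sup (cwDeg G Y)) + ∑ v ∈ X, cwF d (cwDeg G Y v)

lemma cwPhi_mono (d : ℕ) (X : Finset V) {Y Y' : Finset V} (h : Y' ⊆ Y) :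
    cwPhi G d X Y ≤ cwPhi G d X Y' := by
  unfold cwPhi
  gcongr with v hv
  · exact cwF_anti d (Finset.sup_mono_fun fun v _ => cwDeg_mono G h v)
  · exact cwF_anti d (cwDeg_mono G h v)

lemma cwPhi_erase (d : ℕ) {X Y : Finset V} {v : V} (hv : v ∈ X) :
    cwPhi G d X Y ≤ cwPhi G d (X.erase v) Y + 1 := by
  unfold cwPhi
  rw [← add_sum_erase X _ hv]
  have h1 := cwF_anti d (Finset.sup_mono (f := cwDeg G Y) (erase_subset v X))
  have h2 := cwF_le_one d (cwDeg G Y v)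
  linarith

/-- the gain on the `Y` side when `v ∈ X` and `w ∈ Y` are deleted -/
lemma cw_sum_gain (d : ℕ) {X Y : Finset V} {v w : V} (hv : v ∈ X) (hw : w ∈ Y)
    (hmin : ∀ u ∈ Y, d + 1 ≤ cwDeg G X u) :
    ∑ u ∈ Y, cwF d (cwDeg G X u) - cwF d (cwDeg G X w)
      + (cwDeg G (Y.erase w) v : ℝ) * cwC d (Y.sup (cwDeg G X))
      ≤ ∑ u ∈ Y.erase w, cwF d (cwDeg G (X.erase v) u) := by
  rw [← add_sum_erase Y _ hw]
  have h1 : (cwDeg G (Y.erase w) v : ℝ) * cwC d (Y.sup (cwDeg G X))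
      = ∑ u ∈ Y.erase w, if G.Adj v u then cwC d (Y.sup (cwDeg G X)) else 0 := by
    rw [← sum_filter, sum_const, nsmul_eq_mul, cwDeg]
  rw [h1, add_sub_cancel_left, ← sum_add_distrib]
  apply sum_le_sum
  intro u hu
  have huY := mem_of_mem_erase hu
  split_ifs with h
  · rw [cwDeg_erase_adj G hv h.symm, cwF_pred d _ (hmin u huY)]
    have := cwC_anti d (by have := hmin u huY; omega) (Finset.le_sup (f := cwDeg G X) huY)
    linarith
  · rw [cwDeg_erase_not G (fun h' => h h'.symm), add_zero]

lemma cw_main (d : ℕ) (A B : Finset V)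
    (hAA : ∀ u ∈ A, ∀ v ∈ A, ¬ G.Adj u v) (hBB : ∀ u ∈ B, ∀ v ∈ B, ¬ G.Adj u v)
    (hAB : Disjoint A B) (m : ℕ) :
    ∀ X Y : Finset V, X ⊆ A → Y ⊆ B → X.card + Y.card = m →
      ∃ S T : Finset V, S ⊆ X ∧ T ⊆ Y ∧ X.card + T.card = Y.card + S.card ∧
        (∀ s : Finset V, s ⊆ S ∪ T → s.Nonempty →
          ∃ v ∈ s, (s.filter (fun u => G.Adj v u)).card ≤ d) ∧
        cwPhi G d X Y + cwPhi G d Y X ≤ S.card + T.card + 2 := by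
  induction m using Nat.strong_induction_on with
  | _ m ih =>
  intro X Y hX hY hm
  by_cases h1 : ∃ v ∈ X, cwDeg G Y v ≤ d
  · obtain ⟨v, hv, hvd⟩ := h1
    have hc := card_erase_add_one hv
    obtain ⟨S, T, hS, hT, hbal, hdeg, hphi⟩ := ih (m - 1) (by omega) (X.erase v) Y
      ((erase_subset _ _).trans hX) hY (by omega)
    have hvS : v ∉ S := fun h => notMem_erase v X (hS h)
    refine ⟨insert v S, T, ?_, hT, ?_, ?_, ?_⟩
    · exact insert_subset hv (hS.trans (erase_subset _ _))
    · rw [card_insert_of_notMem hvS]; omega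
    · intro s hs hne
      by_cases hvs : v ∈ s
      · refine ⟨v, hvs, le_trans (card_le_card ?_) hvd⟩
        intro u hu
        rw [mem_filter] at hu ⊢
        refine ⟨?_, hu.2⟩
        have h3 := hs hu.1
        rw [mem_union, mem_insert] at h3
        rcases h3 with (rfl | h3) | h3
        · exact absurd hu.2 (G.irrefl)
        · exact absurd hu.2 (hAA _ (hX hv) _ (hX (mem_of_mem_erase (hS h3))))
        · exact hT h3
      · refine hdeg s ?_ hne
        intro u hu
        have h3 := hs hu
        rw [insert_union, mem_insert] at h3
        rcases h3 with rfl | h3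
        · exact absurd hu hvs
        · exact h3
    · rw [card_insert_of_notMem hvS]
      push_cast
      have := cwPhi_erase G d (Y := Y) hv
      have := cwPhi_mono G d Y (erase_subset v X)
      linarith
  by_cases h2 : ∃ v ∈ Y, cwDeg G X v ≤ d
  · obtain ⟨v, hv, hvd⟩ := h2
    have hc := card_erase_add_one hv
    obtain ⟨S, T, hS, hT, hbal, hdeg, hphi⟩ := ih (m - 1) (by omega) X (Y.erase v)
      hX ((erase_subset _ _).trans hY) (by omega)
    have hvT : v ∉ T := fun h => notMem_erase v Y (hT h)
    refine ⟨S, insert v T, hS, ?_, ?_, ?_, ?_⟩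
    · exact insert_subset hv (hT.trans (erase_subset _ _))
    · rw [card_insert_of_notMem hvT]; omega
    · intro s hs hne
      by_cases hvs : v ∈ s
      · refine ⟨v, hvs, le_trans (card_le_card ?_) hvd⟩
        intro u hu
        rw [mem_filter] at hu ⊢
        refine ⟨?_, hu.2⟩
        have h3 := hs hu.1
        rw [mem_union, mem_insert] at h3
        rcases h3 with h3 | (rfl | h3)
        · exact hS h3
        · exact absurd hu.2 (G.irrefl)
        · exact absurd hu.2 (hBB _ (hY hv) _ (hY (mem_of_mem_erase (hT h3))))
      · refine hdeg s ?_ hne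
        intro u hu
        have h3 := hs hu
        rw [union_insert, mem_insert] at h3
        rcases h3 with rfl | h3
        · exact absurd hu hvs
        · exact h3
    · rw [card_insert_of_notMem hvT]
      push_cast
      have := cwPhi_erase G d (Y := X) hv
      have := cwPhi_mono G d X (erase_subset v Y)
      linarith
  push Not at h1 h2
  rcases X.eq_empty_or_nonempty with hX0 | hXne
  · have hY0 : Y = ∅ := by
      rw [eq_empty_iff_forall_notMem]
      intro w hw
      have := h2 w hw
      simp [hX0, cwDeg] at this
    subst hX0 hY0
    refine ⟨∅, ∅, by simp, by simp, by simp, ?_, ?_⟩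
    · intro s hs hne
      simp at hs
      simp [hs] at hne
    · have := cwF_le_one d 0
      simp [cwPhi]
      linarith
  have hYne : Y.Nonempty := by
    obtain ⟨v, hv⟩ := hXne
    rw [nonempty_iff_ne_empty]
    rintro rfl
    have := h1 v hv
    simp [cwDeg] at this
  -- choose the pair to be deleted
  have key : ∃ v ∈ X, ∃ w ∈ Y, cwPhi G d X Y + cwPhi G d Y X
      ≤ cwPhi G d (X.erase v) (Y.erase w) + cwPhi G d (Y.erase w) (X.erase v) := by
    obtain ⟨v0, hv0, hv0x⟩ := exists_mem_eq_sup X hXne (cwDeg G Y)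
    obtain ⟨w0, hw0, hw0y⟩ := exists_mem_eq_sup Y hYne (cwDeg G X)
    have hx : d + 1 ≤ X.sup (cwDeg G Y) := by rw [hv0x]; exact h1 v0 hv0
    have hy : d + 1 ≤ Y.sup (cwDeg G X) := by rw [hw0y]; exact h2 w0 hw0
    have hin := cw_ineq d _ _ hx hy
    by_cases hna : ∃ v ∈ X, ∃ w ∈ Y, cwDeg G Y v = X.sup (cwDeg G Y) ∧
        cwDeg G X w = Y.sup (cwDeg G X) ∧ ¬ G.Adj v w
    · obtain ⟨v, hv, w, hw, hvx, hwy, hadj⟩ := hna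
      refine ⟨v, hv, w, hw, ?_⟩
      have g1 := cw_sum_gain G d hv hw h2
      have g2 := cw_sum_gain G d hw hv h1
      rw [cwDeg_erase_not G hadj, hvx, hwy] at g1
      rw [cwDeg_erase_not G (fun h => hadj h.symm), hvx, hwy] at g2
      have m1 : cwF d (X.sup (cwDeg G Y)) ≤ cwF d ((X.erase v).sup (cwDeg G (Y.erase w))) :=
        cwF_anti d (Finset.sup_le fun u hu => (cwDeg_mono G (erase_subset _ _) u).trans
          (Finset.le_sup (f := cwDeg G Y) (mem_of_mem_erase hu)))
      have m2 : cwF d (Y.sup (cwDeg G X)) ≤ cwF d ((Y.erase w).sup (cwDeg G (X.erase v))) :=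
        cwF_anti d (Finset.sup_le fun u hu => (cwDeg_mono G (erase_subset _ _) u).trans
          (Finset.le_sup (f := cwDeg G X) (mem_of_mem_erase hu)))
      unfold cwPhi
      linarith
    · push Not at hna
      refine ⟨v0, hv0, w0, hw0, ?_⟩
      have hadj := hna v0 hv0 w0 hw0 hv0x.symm hw0y.symm
      have g1 := cw_sum_gain G d hv0 hw0 h2
      have g2 := cw_sum_gain G d hw0 hv0 h1
      rw [cwDeg_erase_adj G hw0 hadj, ← hv0x, ← hw0y, Nat.cast_sub (by omega)] at g1
      rw [cwDeg_erase_adj G hv0 hadj.symm, ← hv0x, ← hw0y, Nat.cast_sub (by omega)] at g2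
      have m1 : cwF d (X.sup (cwDeg G Y) - 1)
          ≤ cwF d ((X.erase v0).sup (cwDeg G (Y.erase w0))) := by
        refine cwF_anti d (Finset.sup_le fun u hu => ?_)
        have huX := mem_of_mem_erase hu
        have hle := Finset.le_sup (f := cwDeg G Y) huX
        rcases hle.lt_or_eq with hlt | heq
        · have := cwDeg_mono G (erase_subset w0 Y) u
          omega
        · rw [cwDeg_erase_adj G hw0 (hna u huX w0 hw0 heq hw0y.symm), heq]
      have m2 : cwF d (Y.sup (cwDeg G X) - 1)
          ≤ cwF d ((Y.erase w0).sup (cwDeg G (X.erase v0))) := by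
        refine cwF_anti d (Finset.sup_le fun u hu => ?_)
        have huY := mem_of_mem_erase hu
        have hle := Finset.le_sup (f := cwDeg G X) huY
        rcases hle.lt_or_eq with hlt | heq
        · have := cwDeg_mono G (erase_subset v0 X) u
          omega
        · rw [cwDeg_erase_adj G hv0 (hna v0 hv0 u huY hv0x.symm heq).symm, heq]
      rw [cwF_pred d _ hx] at m1
      rw [cwF_pred d _ hy] at m2
      push_cast at g1 g2
      unfold cwPhi
      linarith
  obtain ⟨v, hv, w, hw, hk⟩ := key
  have hcv := card_erase_add_one hv
  have hcw := card_erase_add_one hw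
  obtain ⟨S, T, hS, hT, hbal, hdeg, hphi⟩ := ih (m - 2) (by omega) (X.erase v) (Y.erase w)
    ((erase_subset _ _).trans hX) ((erase_subset _ _).trans hY) (by omega)
  exact ⟨S, T, hS.trans (erase_subset _ _), hT.trans (erase_subset _ _), by omega, hdeg,
    hk.trans hphi⟩

end

/-- For an integer `d ≥ 1`, an `n × n` bipartite graph `G` (with `n ≥ 1`),
`Δ_A`, `Δ_B` the maximum degrees on the two sides, and `f(x) = min(1, (d+1)/(x+1))`,
`β_d(G) ≥ (1/2)·(f(Δ_A) + f(Δ_B) + ∑_{v ∈ A ∪ B} f(d(v))) − 1`. -/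
theorem degen_bihole_caro_wei_strong {V : Type*} [Fintype V] [DecidableEq V]
    (d : ℕ) (hd : 1 ≤ d)
    (G : SimpleGraph V) [DecidableRel G.Adj] (n : ℕ) (hn : 1 ≤ n) (A B : Finset V)
    (hdisj : Disjoint A B) (hcover : A ∪ B = Finset.univ)
    (hbip : ∀ u v, G.Adj u v → (u ∈ A ∧ v ∈ B) ∨ (u ∈ B ∧ v ∈ A))
    (hA : A.card = n) (hB : B.card = n)
    (f : ℝ → ℝ) (hf : ∀ x : ℝ, f x = min 1 (((d : ℝ) + 1) / (x + 1))) :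
    (1 / 2 : ℝ) * (f ((A.sup (fun v => G.degree v) : ℕ) : ℝ) + f ((B.sup (fun v => G.degree v) : ℕ) : ℝ)
        + ∑ v ∈ A ∪ B, f (G.degree v)) - 1
      ≤ (degenBiholeNumber d G A B : ℝ) := by
  have hAA : ∀ u ∈ A, ∀ v ∈ A, ¬ G.Adj u v := by
    intro u hu v hv h
    rcases hbip u v h with h' | h'
    · exact (Finset.disjoint_left.mp hdisj hv) h'.2
    · exact (Finset.disjoint_left.mp hdisj hu) h'.1
  have hBB : ∀ u ∈ B, ∀ v ∈ B, ¬ G.Adj u v := by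
    intro u hu v hv h
    rcases hbip u v h with h' | h'
    · exact (Finset.disjoint_left.mp hdisj h'.1) hu
    · exact (Finset.disjoint_left.mp hdisj h'.2) hv
  obtain ⟨S, T, hS, hT, hbal, hdeg, hphi⟩ :=
    cw_main G d A B hAA hBB hdisj _ A B (Finset.Subset.refl _) (Finset.Subset.refl _) rfl
  have hcard : T.card = S.card := by omega
  have hle : S.card ≤ degenBiholeNumber d G A B := by
    apply le_csSup
    · refine ⟨n, ?_⟩
      rintro k ⟨S', T', hS', _, hk, _⟩
      rw [← hk, ← hA]
      exact Finset.card_le_card hS'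
    · exact ⟨S, T, hS, hT, rfl, hcard, hdeg⟩
  have hle' : (S.card : ℝ) ≤ degenBiholeNumber d G A B := by exact_mod_cast hle
  have hfF : ∀ k : ℕ, f (k : ℝ) = cwF d k := fun k => hf k
  have hdg : ∀ (Z : Finset V) (v : V), cwDeg G Z v ≤ G.degree v := by
    intro Z v
    rw [← G.card_neighborFinset_eq_degree]
    apply Finset.card_le_card
    intro u hu
    simpa using (Finset.mem_filter.mp hu).2
  have hPhi : ∀ Z W : Finset V, f ((Z.sup (fun v => G.degree v) : ℕ) : ℝ)
      + ∑ v ∈ Z, f (G.degree v) ≤ cwPhi G d Z W := by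
    intro Z W
    unfold cwPhi
    simp only [hfF]
    gcongr with v hv
    · exact cwF_anti d (Finset.sup_mono_fun fun v _ => hdg W v)
    · exact cwF_anti d (hdg W v)
  have p1 := hPhi A B
  have p2 := hPhi B A
  rw [Finset.sum_union hdisj]
  rw [hcard] at hphi
  linarith
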